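/- Let a > 1 and let γ = (γ_k) be a sequence in the open unit disc with 0 < inf_k|γ_k| ≤ sup_k|γ_k| < 1, and let n ∈ ℕ. If D₁(γ) is of class Cⁿ(A_a), then D₂(γ) and the GGT operator H(γ) are also of class Cⁿ(A_a). -/

import Mathlib

open scoped ComplexInnerProductSpace

noncomputable section

/-- `ℓ²(ℤ)`. -/
abbrev l2Z : Type := lp (fun _ : ℤ => ℂ) 2

/-- A bounded operator `B` is of class `Cⁿ(A)` (with core `A.domain`): there is a chain
`B₀ = B, B₁, …` of bounded operators with
`⟨Aφ, Bⱼψ⟩ − ⟨φ, Bⱼ(Aψ)⟩ = ⟨φ, B_{j+1}ψ⟩` on `A.domain` for all `j < n`. -/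
def IsCn (A : l2Z →ₗ.[ℂ] l2Z) (n : ℕ) (B : l2Z →L[ℂ] l2Z) : Prop :=
  ∃ Bs : ℕ → (l2Z →L[ℂ] l2Z), Bs 0 = B ∧
    ∀ j < n, ∀ φ ψ : A.domain,
      ⟪A φ, Bs j (ψ : l2Z)⟫ - ⟪(φ : l2Z), Bs j (A ψ)⟫ = ⟪(φ : l2Z), Bs (j + 1) (ψ : l2Z)⟫

open Filter Topology

/-- `B'` represents the commutator form of `A` and `B` on `A.domain`. -/
def HasCommutator (A : l2Z →ₗ.[ℂ] l2Z) (B B' : l2Z →L[ℂ] l2Z) : Prop :=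
  ∀ φ ψ : A.domain, ⟪A φ, B (ψ : l2Z)⟫ - ⟪(φ : l2Z), B (A ψ)⟫ = ⟪(φ : l2Z), B' (ψ : l2Z)⟫

/-- `x` lies in the domain of the adjoint of `A`, which maps it to `x'`. -/
def AdjointMapsTo (A : l2Z →ₗ.[ℂ] l2Z) (x x' : l2Z) : Prop :=
  ∀ φ : A.domain, ⟪A φ, x⟫ = ⟪(φ : l2Z), x'⟫

/-- `A` is symmetric and so is its adjoint. -/
structure IsEssSymm (A : l2Z →ₗ.[ℂ] l2Z) : Prop where
  symm : ∀ φ : A.domain, AdjointMapsTo A φ (A φ)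
  adjoint_symm : ∀ ⦃x x' y y' : l2Z⦄, AdjointMapsTo A x x' → AdjointMapsTo A y y' →
    ⟪x', y⟫ = ⟪x, y'⟫

namespace HasCommutator

variable {A : l2Z →ₗ.[ℂ] l2Z} {B B' C C' : l2Z →L[ℂ] l2Z}

theorem one (hA : IsEssSymm A) : HasCommutator A 1 0 := fun φ ψ => by
  simpa [sub_eq_zero] using hA.symm ψ φ

theorem zero : HasCommutator A 0 0 := fun φ ψ => by simp

theorem add (hB : HasCommutator A B B') (hC : HasCommutator A C C') :
    HasCommutator A (B + C) (B' + C') := fun φ ψ => by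
  simp only [add_apply, inner_add_right, ← hB φ ψ, ← hC φ ψ]
  ring

theorem smul (c : ℂ) (hB : HasCommutator A B B') : HasCommutator A (c • B) (c • B') :=
  fun φ ψ => by
    simp only [smul_apply, inner_smul_right, ← hB φ ψ]
    ring

protected theorem star (hB : HasCommutator A B B') :
    HasCommutator A (star B) (-star B') := fun φ ψ => by
  have h := congrArg (starRingEnd ℂ) (hB ψ φ)
  simp only [map_sub, inner_conj_symm] at h
  simp only [ContinuousLinearMap.star_eq_adjoint, neg_apply, inner_neg_right,
    ContinuousLinearMap.adjoint_inner_right, ← h]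
  ring

theorem adjointMapsTo (hB : HasCommutator A B B') (ψ : A.domain) :
    AdjointMapsTo A (B ψ) (B (A ψ) + B' ψ) := fun φ => by
  rw [inner_add_right, ← hB φ ψ]
  ring

theorem mul (hA : IsEssSymm A) (hB : HasCommutator A B B') (hC : HasCommutator A C C') :
    HasCommutator A (B * C) (B' * C + B * C') := fun φ ψ => by
  have h := hA.adjoint_symm (hB.star.adjointMapsTo φ) (hC.adjointMapsTo ψ)
  simp only [ContinuousLinearMap.star_eq_adjoint, neg_apply, inner_neg_left,
    ContinuousLinearMap.adjoint_inner_left, inner_add_left, inner_add_right] at h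
  simp only [mul_apply_eq_comp, add_apply, inner_add_right]
  linear_combination h

theorem of_tendsto {b b' : ℕ → l2Z →L[ℂ] l2Z} (h : ∀ n, HasCommutator A (b n) (b' n))
    (hb : Tendsto b atTop (𝓝 B)) (hb' : Tendsto b' atTop (𝓝 B')) : HasCommutator A B B' :=
  fun φ ψ => by
    have key : ∀ {c : ℕ → l2Z →L[ℂ] l2Z} {D : l2Z →L[ℂ] l2Z} (x y : l2Z),
        Tendsto c atTop (𝓝 D) → Tendsto (fun n => ⟪x, c n y⟫) atTop (𝓝 ⟪x, D y⟫) :=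
      fun x y hc => tendsto_const_nhds.inner
        (((ContinuousLinearMap.apply ℂ l2Z y).continuous.tendsto _).comp hc)
    refine tendsto_nhds_unique ((key _ _ hb).sub (key _ _ hb)) ?_
    exact (key _ _ hb').congr fun n => (h n φ ψ).symm

end HasCommutator

theorem tendsto_zero_of_le_mul_add {q : ℝ} (hq0 : 0 ≤ q) (hq : q < 1) {e d : ℕ → ℝ}
    (he : ∀ n, 0 ≤ e n) (hd : Tendsto d atTop (𝓝 0)) (h : ∀ n, e (n + 1) ≤ q * e n + d n) :
    Tendsto e atTop (𝓝 0) := by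
  rw [Metric.tendsto_atTop]
  intro ε hε
  obtain ⟨N, hN⟩ := (hd.eventually (gt_mem_nhds (show 0 < (1 - q) * (ε / 2) by
    have := sub_pos.2 hq; positivity))).exists_forall_of_atTop
  have hpow : ∀ k, e (N + k) ≤ ε / 2 + q ^ k * e N := by
    intro k
    induction k with
    | zero => simp; linarith
    | succ k ih =>
      have h1 := h (N + k)
      have h2 := hN (N + k) (by omega)
      have h3 := mul_le_mul_of_nonneg_left ih hq0
      rw [← add_assoc, pow_succ]
      linarith
  have hlim : Tendsto (fun k => q ^ k * e N) atTop (𝓝 0) := by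
    simpa using (tendsto_pow_atTop_nhds_zero_of_lt_one hq0 hq).mul_const (e N)
  obtain ⟨K, hK⟩ := (hlim.eventually (gt_mem_nhds (half_pos hε))).exists_forall_of_atTop
  refine ⟨N + K, fun n hn => ?_⟩
  obtain ⟨k, rfl⟩ := Nat.exists_eq_add_of_le hn
  have h1 := hpow (K + k)
  have h2 := hK (K + k) (by omega)
  rw [Real.dist_0_eq_abs, abs_of_nonneg (he _), add_assoc]
  linarith

theorem tendsto_of_norm_sub_le {E : Type*} [NormedAddCommGroup E] {q : ℝ} (hq0 : 0 ≤ q)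
    (hq : q < 1) {u : ℕ → E} {x : E} {d : ℕ → ℝ} (hd : Tendsto d atTop (𝓝 0))
    (h : ∀ n, ‖u (n + 1) - x‖ ≤ q * ‖u n - x‖ + d n) : Tendsto u atTop (𝓝 x) :=
  tendsto_iff_norm_sub_tendsto_zero.2 <|
    tendsto_zero_of_le_mul_add hq0 hq (fun _ => norm_nonneg _) hd h

theorem exists_eq_add_mul_add_mul {E : Type*} [NormedRing E] [CompleteSpace E] {P Q : E}
    (h : ‖P‖ + ‖Q‖ < 1) (V : E) : ∃ W, W = V + P * W + W * Q := by
  have hf : ContractingWith (‖P‖₊ + ‖Q‖₊) fun W => V + P * W + W * Q := by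
    refine ⟨by exact_mod_cast h, LipschitzWith.of_dist_le_mul fun x y => ?_⟩
    have : V + P * x + x * Q - (V + P * y + y * Q) = P * (x - y) + (x - y) * Q := by noncomm_ring
    rw [dist_eq_norm, dist_eq_norm, this]
    refine (norm_add_le _ _).trans ((add_le_add (norm_mul_le _ _) (norm_mul_le _ _)).trans ?_)
    push_cast
    rw [add_mul, mul_comm ‖x - y‖]
  exact ⟨_, hf.fixedPoint_isFixedPt.symm⟩

namespace HasCommutator

variable {A : l2Z →ₗ.[ℂ] l2Z}

theorem exists_of_eq_add_mul_add_mul (hA : IsEssSymm A) {V V' P P' Q Q' W : l2Z →L[ℂ] l2Z}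
    (hV : HasCommutator A V V') (hP : HasCommutator A P P') (hQ : HasCommutator A Q Q')
    (h : ‖P‖ + ‖Q‖ < 1) (hW : W = V + P * W + W * Q) :
    ∃ W', W' = (V' + P' * W + W * Q') + P * W' + W' * Q ∧ HasCommutator A W W' := by
  obtain ⟨W', hW'⟩ := exists_eq_add_mul_add_mul h (V' + P' * W + W * Q')
  refine ⟨W', hW', ?_⟩
  let u : ℕ → (l2Z →L[ℂ] l2Z) × (l2Z →L[ℂ] l2Z) := fun n =>
    Nat.rec (0, 0) (fun _ p => (V + P * p.1 + p.1 * Q,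
      (V' + P' * p.1 + p.1 * Q') + P * p.2 + p.2 * Q)) n
  have hu : ∀ n, HasCommutator A (u n).1 (u n).2 := by
    intro n
    induction n with
    | zero => exact zero
    | succ n ih =>
      convert (hV.add (hP.mul hA ih)).add (ih.mul hA hQ) using 1
      change (V' + P' * (u n).1 + (u n).1 * Q') + P * (u n).2 + (u n).2 * Q = _
      abel
  have hq0 : 0 ≤ ‖P‖ + ‖Q‖ := by positivity
  have hbound : ∀ X : l2Z →L[ℂ] l2Z, ‖P * X + X * Q‖ ≤ (‖P‖ + ‖Q‖) * ‖X‖ := fun X => by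
    refine (norm_add_le _ _).trans ((add_le_add (norm_mul_le _ _) (norm_mul_le _ _)).trans ?_)
    rw [add_mul, mul_comm ‖X‖]
  have h1 : Tendsto (fun n => (u n).1) atTop (𝓝 W) := by
    refine tendsto_of_norm_sub_le hq0 h (d := fun _ => 0) tendsto_const_nhds fun n => ?_
    have : (u (n + 1)).1 - W = P * ((u n).1 - W) + ((u n).1 - W) * Q := by
      nth_rewrite 1 [hW]
      change V + P * (u n).1 + (u n).1 * Q - _ = _
      noncomm_ring
    rw [this, add_zero]
    exact hbound _
  refine of_tendsto hu h1 (tendsto_of_norm_sub_le hq0 h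
    (d := fun n => ‖P' * ((u n).1 - W) + ((u n).1 - W) * Q'‖) ?_ fun n => ?_)
  · have h2 : Tendsto (fun n => (u n).1 - W) atTop (𝓝 0) := by simpa using h1.sub_const W
    simpa using ((h2.const_mul P').add (h2.mul_const Q')).norm
  · have : (u (n + 1)).2 - W' = (P * ((u n).2 - W') + ((u n).2 - W') * Q) +
        (P' * ((u n).1 - W) + ((u n).1 - W) * Q') := by
      nth_rewrite 1 [hW']
      change (V' + P' * (u n).1 + (u n).1 * Q') + P * (u n).2 + (u n).2 * Q - _ = _
      noncomm_ring
    rw [this]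
    exact (norm_add_le _ _).trans (add_le_add_left (hbound _) _)

theorem exists_of_eq_half_add_mul_self (hA : IsEssSymm A) {Y Y' Z : l2Z →L[ℂ] l2Z} {z : ℝ}
    (hz : z < 1) (hZz : ‖Z‖ ≤ z) (hYz : ‖Y‖ ≤ 2 * z - z ^ 2) (hY : HasCommutator A Y Y')
    (hZ : Z = (1 / 2 : ℂ) • (Y + Z * Z)) :
    ∃ Z', Z' = (1 / 2 : ℂ) • Y' + ((1 / 2 : ℂ) • Z) * Z' + Z' * ((1 / 2 : ℂ) • Z) ∧
      HasCommutator A Z Z' := by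
  have hz0 : 0 ≤ z := (norm_nonneg _).trans hZz
  have hhalf : ‖(1 / 2 : ℂ)‖ = 1 / 2 := by norm_num
  have hlt : ‖(1 / 2 : ℂ) • Z‖ + ‖(1 / 2 : ℂ) • Z‖ < 1 := by
    rw [norm_smul, hhalf]
    linarith
  obtain ⟨Z', hZ'⟩ := exists_eq_add_mul_add_mul hlt ((1 / 2 : ℂ) • Y')
  refine ⟨Z', hZ', ?_⟩
  have hZ'' : Z' = (1 / 2 : ℂ) • (Y' + (Z' * Z + Z * Z')) := by
    nth_rewrite 1 [hZ']
    simp only [smul_mul_assoc, mul_smul_comm, smul_add]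
    abel
  let u : ℕ → (l2Z →L[ℂ] l2Z) × (l2Z →L[ℂ] l2Z) := fun n =>
    Nat.rec (0, 0) (fun _ p => ((1 / 2 : ℂ) • (Y + p.1 * p.1),
      (1 / 2 : ℂ) • (Y' + (p.2 * p.1 + p.1 * p.2)))) n
  have hu : ∀ n, HasCommutator A (u n).1 (u n).2 := by
    intro n
    induction n with
    | zero => exact zero
    | succ n ih => exact (hY.add (ih.mul hA ih)).smul _
  have hnorm : ∀ n, ‖(u n).1‖ ≤ z := by
    intro n
    induction n with
    | zero => simpa [u] using hz0
    | succ n ih =>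
      change ‖(1 / 2 : ℂ) • (Y + (u n).1 * (u n).1)‖ ≤ z
      rw [norm_smul, hhalf]
      have h1 := norm_add_le Y ((u n).1 * (u n).1)
      have h2 := norm_mul_le (u n).1 (u n).1
      have h3 := mul_le_mul ih ih (norm_nonneg _) hz0
      linarith
  have h1 : Tendsto (fun n => (u n).1) atTop (𝓝 Z) := by
    refine tendsto_of_norm_sub_le hz0 hz (d := fun _ => 0) tendsto_const_nhds fun n => ?_
    have : (u (n + 1)).1 - Z =
        (1 / 2 : ℂ) • ((u n).1 * ((u n).1 - Z) + ((u n).1 - Z) * Z) := by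
      nth_rewrite 1 [hZ]
      change (1 / 2 : ℂ) • (Y + (u n).1 * (u n).1) - _ = _
      rw [← smul_sub]
      congr 1
      noncomm_ring
    rw [this, add_zero, norm_smul, hhalf]
    have h2 := norm_add_le ((u n).1 * ((u n).1 - Z)) (((u n).1 - Z) * Z)
    have h3 := norm_mul_le (u n).1 ((u n).1 - Z)
    have h4 := norm_mul_le ((u n).1 - Z) Z
    have h5 := mul_le_mul_of_nonneg_right (hnorm n) (norm_nonneg ((u n).1 - Z))
    have h6 := mul_le_mul_of_nonneg_left hZz (norm_nonneg ((u n).1 - Z))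
    linarith
  refine of_tendsto hu h1 (tendsto_of_norm_sub_le hz0 hz
    (d := fun n => ‖(1 / 2 : ℂ) • (Z' * ((u n).1 - Z) + ((u n).1 - Z) * Z')‖) ?_ fun n => ?_)
  · have h2 : Tendsto (fun n => (u n).1 - Z) atTop (𝓝 0) := by simpa using h1.sub_const Z
    simpa using (((h2.const_mul Z').add (h2.mul_const Z')).const_smul (1 / 2 : ℂ)).norm
  · have : (u (n + 1)).2 - Z' =
        (1 / 2 : ℂ) • (((u n).2 - Z') * (u n).1 + (u n).1 * ((u n).2 - Z')) +
        (1 / 2 : ℂ) • (Z' * ((u n).1 - Z) + ((u n).1 - Z) * Z') := by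
      nth_rewrite 1 [hZ'']
      change (1 / 2 : ℂ) • (Y' + ((u n).2 * (u n).1 + (u n).1 * (u n).2)) - _ = _
      rw [← smul_sub, ← smul_add]
      congr 1
      noncomm_ring
    rw [this]
    refine (norm_add_le _ _).trans (add_le_add_left ?_ _)
    rw [norm_smul, hhalf]
    have h2 := norm_add_le (((u n).2 - Z') * (u n).1) ((u n).1 * ((u n).2 - Z'))
    have h3 := norm_mul_le (u n).1 ((u n).2 - Z')
    have h4 := norm_mul_le ((u n).2 - Z') (u n).1
    have h5 := mul_le_mul_of_nonneg_right (hnorm n) (norm_nonneg ((u n).2 - Z'))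
    linarith

end HasCommutator

namespace IsCn

variable {A : l2Z →ₗ.[ℂ] l2Z} {n : ℕ} {B C : l2Z →L[ℂ] l2Z}

theorem zero_order : IsCn A 0 B := ⟨fun _ => B, rfl, fun _ hj => absurd hj (Nat.not_lt_zero _)⟩

theorem succ_iff : IsCn A (n + 1) B ↔ ∃ B', HasCommutator A B B' ∧ IsCn A n B' := by
  constructor
  · rintro ⟨Bs, rfl, h⟩
    exact ⟨Bs 1, h 0 n.succ_pos, fun j => Bs (j + 1), rfl, fun j hj => h (j + 1) (by omega)⟩
  · rintro ⟨B', hB, Bs, rfl, h⟩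
    refine ⟨fun j => Nat.casesOn j B Bs, rfl, fun j hj => ?_⟩
    cases j with
    | zero => exact hB
    | succ j => exact h j (by omega)

theorem of_succ (h : IsCn A (n + 1) B) : IsCn A n B := by
  obtain ⟨Bs, h0, h⟩ := h
  exact ⟨Bs, h0, fun j hj => h j (by omega)⟩

theorem zero : IsCn A n 0 := by
  induction n with
  | zero => exact zero_order
  | succ n ih => exact succ_iff.2 ⟨0, .zero, ih⟩

theorem one (hA : IsEssSymm A) : IsCn A n 1 := by
  cases n with
  | zero => exact zero_order
  | succ n => exact succ_iff.2 ⟨0, .one hA, zero⟩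

theorem add (hB : IsCn A n B) (hC : IsCn A n C) : IsCn A n (B + C) := by
  induction n generalizing B C with
  | zero => exact zero_order
  | succ n ih =>
    obtain ⟨B', hB, hB'⟩ := succ_iff.1 hB
    obtain ⟨C', hC, hC'⟩ := succ_iff.1 hC
    exact succ_iff.2 ⟨_, hB.add hC, ih hB' hC'⟩

theorem smul (c : ℂ) (hB : IsCn A n B) : IsCn A n (c • B) := by
  induction n generalizing B with
  | zero => exact zero_order
  | succ n ih =>
    obtain ⟨B', hB, hB'⟩ := succ_iff.1 hB
    exact succ_iff.2 ⟨_, hB.smul c, ih hB'⟩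

theorem neg (hB : IsCn A n B) : IsCn A n (-B) := by simpa using hB.smul (-1)

theorem sub (hB : IsCn A n B) (hC : IsCn A n C) : IsCn A n (B - C) := by
  simpa [sub_eq_add_neg] using hB.add hC.neg

protected theorem star (hB : IsCn A n B) : IsCn A n (star B) := by
  induction n generalizing B with
  | zero => exact zero_order
  | succ n ih =>
    obtain ⟨B', hB, hB'⟩ := succ_iff.1 hB
    exact succ_iff.2 ⟨_, hB.star, (ih hB').neg⟩

theorem mul (hA : IsEssSymm A) (hB : IsCn A n B) (hC : IsCn A n C) : IsCn A n (B * C) := by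
  induction n generalizing B C with
  | zero => exact zero_order
  | succ n ih =>
    obtain ⟨B', hB1, hB'⟩ := succ_iff.1 hB
    obtain ⟨C', hC1, hC'⟩ := succ_iff.1 hC
    exact succ_iff.2 ⟨_, hB1.mul hA hC1, (ih hB' hC.of_succ).add (ih hB.of_succ hC')⟩

theorem of_eq_add_mul_add_mul (hA : IsEssSymm A) {V P Q W : l2Z →L[ℂ] l2Z} (hV : IsCn A n V)
    (hP : IsCn A n P) (hQ : IsCn A n Q) (h : ‖P‖ + ‖Q‖ < 1) (hW : W = V + P * W + W * Q) :
    IsCn A n W := by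
  induction n generalizing V W with
  | zero => exact zero_order
  | succ n ih =>
    have hWn : IsCn A n W := ih hV.of_succ hP.of_succ hQ.of_succ hW
    obtain ⟨V', hV1, hV'⟩ := succ_iff.1 hV
    obtain ⟨P', hP1, hP'⟩ := succ_iff.1 hP
    obtain ⟨Q', hQ1, hQ'⟩ := succ_iff.1 hQ
    obtain ⟨W', hW', hWW'⟩ := hV1.exists_of_eq_add_mul_add_mul hA hP1 hQ1 h hW
    exact succ_iff.2 ⟨W', hWW', ih ((hV'.add (hP'.mul hA hWn)).add (hWn.mul hA hQ'))
      hP.of_succ hQ.of_succ hW'⟩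

theorem of_eq_half_add_mul_self (hA : IsEssSymm A) {Y Z : l2Z →L[ℂ] l2Z} {z : ℝ}
    (hz : z < 1) (hZz : ‖Z‖ ≤ z) (hYz : ‖Y‖ ≤ 2 * z - z ^ 2) (hY : IsCn A n Y)
    (hZ : Z = (1 / 2 : ℂ) • (Y + Z * Z)) : IsCn A n Z := by
  induction n with
  | zero => exact zero_order
  | succ n ih =>
    have hZn : IsCn A n Z := ih hY.of_succ
    obtain ⟨Y', hY1, hY'⟩ := succ_iff.1 hY
    obtain ⟨Z', hZ', hZZ'⟩ := hY1.exists_of_eq_half_add_mul_self hA hz hZz hYz hZ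
    refine succ_iff.2 ⟨Z', hZZ', of_eq_add_mul_add_mul hA (hY'.smul _) (hZn.smul _) (hZn.smul _)
      ?_ hZ'⟩
    rw [norm_smul]
    norm_num
    linarith

end IsCn

theorem hasSum_norm_sq (x : l2Z) : HasSum (fun k => ‖x k‖ ^ 2) (‖x‖ ^ 2) := by
  simpa using lp.hasSum_norm (p := 2) (by norm_num) x

theorem hasSum_norm_sq_sub (x : l2Z) (m : ℤ) : HasSum (fun k => ‖x (k - m)‖ ^ 2) (‖x‖ ^ 2) :=
  (Equiv.subRight m).hasSum_iff (f := fun k => ‖x k‖ ^ 2) |>.2 (hasSum_norm_sq x)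

theorem norm_coord_le (x : l2Z) (k : ℤ) : ‖x k‖ ≤ ‖x‖ :=
  lp.norm_apply_le_norm (by norm_num) x k

theorem inner_single_one (k : ℤ) (x : l2Z) : ⟪(lp.single 2 k 1 : l2Z), x⟫ = x k := by
  rw [lp.inner_single_left]
  simp

theorem summable_weight_mul_shift {g : ℤ → ℝ} (hg0 : ∀ m, 0 ≤ g m) (hg : Summable g) (x y : l2Z) :
    Summable fun p : ℤ × ℤ => g p.1 * (‖x (p.2 - p.1)‖ * ‖y p.2‖) := by
  have hsum : ∀ m : ℤ, HasSum (fun k => ‖x (k - m)‖ ^ 2 + ‖y k‖ ^ 2) (‖x‖ ^ 2 + ‖y‖ ^ 2) := fun m =>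
    (hasSum_norm_sq_sub x m).add (hasSum_norm_sq y)
  have hle : ∀ m k : ℤ, ‖x (k - m)‖ * ‖y k‖ ≤ ‖x (k - m)‖ ^ 2 + ‖y k‖ ^ 2 := fun m k => by
    nlinarith [sq_nonneg (‖x (k - m)‖ - ‖y k‖),
      mul_nonneg (norm_nonneg (x (k - m))) (norm_nonneg (y k))]
  have hS : ∀ m : ℤ, Summable fun k => ‖x (k - m)‖ * ‖y k‖ := fun m =>
    (hsum m).summable.of_nonneg_of_le (fun k => by positivity) (hle m)
  have h0 : 0 ≤ fun p : ℤ × ℤ => g p.1 * (‖x (p.2 - p.1)‖ * ‖y p.2‖) := fun p =>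
    mul_nonneg (hg0 p.1) (mul_nonneg (norm_nonneg _) (norm_nonneg _))
  refine (summable_prod_of_nonneg h0).2 ⟨fun m => (hS m).mul_left (g m), ?_⟩
  refine (hg.mul_right (‖x‖ ^ 2 + ‖y‖ ^ 2)).of_nonneg_of_le
    (fun m => tsum_nonneg fun k => h0 (m, k)) fun m => ?_
  dsimp only
  rw [tsum_mul_left]
  refine mul_le_mul_of_nonneg_left ?_ (hg0 m)
  rw [← (hsum m).tsum_eq]
  exact (hS m).tsum_le_tsum (hle m) (hsum m).summable

/-- A nonnegative even kernel on `ℤ` with summable first moment. -/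
structure IsMomentKernel (s : ℤ → ℝ) : Prop where
  nonneg : ∀ m, 0 ≤ s m
  even : ∀ m, s (-m) = s m
  summable : Summable s
  summable_moment : Summable fun m : ℤ => |(m : ℝ)| * s m

/-- `x'` arises from `x` by the matrix with entries `(k + j) / 2 * s (k - j)`. -/
def IsKernelPair (s : ℤ → ℝ) (x x' : l2Z) : Prop :=
  ∀ k : ℤ, x' k = (1 / 2 : ℂ) * ∑' m : ℤ, (s m : ℂ) * (2 * (k : ℂ) - (m : ℂ)) * x (k - m)

/-- The `N`-th term of a sequence of cutoffs on `ℤ` increasing to `1`. -/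
def cutoff (N : ℕ) (k : ℤ) : ℝ := ((N : ℝ) + 1) ^ 2 / (((N : ℝ) + 1) ^ 2 + (k : ℝ) ^ 2)

theorem cutoff_nonneg (N : ℕ) (k : ℤ) : 0 ≤ cutoff N k := by
  unfold cutoff
  positivity

theorem cutoff_le_one (N : ℕ) (k : ℤ) : cutoff N k ≤ 1 := by
  unfold cutoff
  exact div_le_one_of_le₀ (by nlinarith [sq_nonneg (k : ℝ)]) (by positivity)

theorem tendsto_cutoff (k : ℤ) : Tendsto (fun N => cutoff N k) atTop (𝓝 1) := by
  have h : ∀ N : ℕ, cutoff N k = 1 - (k : ℝ) ^ 2 / (((N : ℝ) + 1) ^ 2 + (k : ℝ) ^ 2) := fun N => by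
    unfold cutoff
    field_simp
    ring
  simp_rw [h]
  have h0 : Tendsto (fun N : ℕ => (N : ℝ) + 1) atTop atTop :=
    tendsto_atTop_add_const_right _ _ tendsto_natCast_atTop_atTop
  have h1 : Tendsto (fun N : ℕ => ((N : ℝ) + 1) ^ 2 + (k : ℝ) ^ 2) atTop atTop :=
    tendsto_atTop_add_const_right _ _ ((tendsto_pow_atTop two_ne_zero).comp h0)
  simpa using (tendsto_const_nhds (x := (1 : ℝ))).sub (h1.const_div_atTop ((k : ℝ) ^ 2))

theorem cutoff_mul_abs_le (N : ℕ) (k : ℤ) : cutoff N k * |(k : ℝ)| ≤ N + 1 := by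
  unfold cutoff
  have hN : (0 : ℝ) < (N : ℝ) + 1 := by positivity
  rw [div_mul_eq_mul_div, div_le_iff₀ (by positivity), ← sq_abs (k : ℝ)]
  nlinarith [mul_nonneg hN.le (sq_nonneg ((N : ℝ) + 1 - |(k : ℝ)|)),
    mul_nonneg hN.le (sq_nonneg ((N : ℝ) + 1)), mul_nonneg hN.le (sq_nonneg |(k : ℝ)|)]

theorem abs_cutoff_sub_mul_le (N : ℕ) (k m : ℤ) :
    |cutoff N k - cutoff N (k - m)| * |2 * (k : ℝ) - m| ≤ 2 * |(m : ℝ)| := by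
  have hN : (0 : ℝ) < (N : ℝ) + 1 := by positivity
  unfold cutoff
  push_cast
  generalize (N : ℝ) + 1 = t at *
  generalize (k : ℝ) = u
  generalize (m : ℝ) = v
  have h1 : 0 < t ^ 2 + u ^ 2 := by positivity
  have h2 : 0 < t ^ 2 + (u - v) ^ 2 := by positivity
  have h : (t ^ 2 / (t ^ 2 + u ^ 2) - t ^ 2 / (t ^ 2 + (u - v) ^ 2)) * (2 * u - v) =
      -v * (t ^ 2 * (2 * u - v) ^ 2 / ((t ^ 2 + u ^ 2) * (t ^ 2 + (u - v) ^ 2))) := by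
    field_simp
    ring
  rw [← abs_mul, h, abs_mul, abs_neg, mul_comm 2 |v|]
  refine mul_le_mul_of_nonneg_left ?_ (abs_nonneg _)
  rw [abs_of_nonneg (by positivity), div_le_iff₀ (by positivity)]
  nlinarith [mul_nonneg (sq_nonneg t) (sq_nonneg v), sq_nonneg (t ^ 2),
    mul_nonneg (sq_nonneg u) (sq_nonneg (u - v))]

/-- The terms of the sesquilinear form of the kernel operator after cutting off one variable. -/
def cutoffTerm (s : ℤ → ℝ) (N : ℕ) (x y : l2Z) (p : ℤ × ℤ) : ℂ :=
  (cutoff N p.2 : ℂ) * ((1 / 2) * ((s p.1 : ℂ) * (2 * (p.2 : ℂ) - (p.1 : ℂ)))) *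
    (starRingEnd ℂ (x (p.2 - p.1)) * y p.2)

namespace IsMomentKernel

variable {s : ℤ → ℝ}

theorem summable_row (hs : IsMomentKernel s) (x : l2Z) (k : ℤ) :
    Summable fun m : ℤ => (s m : ℂ) * (2 * (k : ℂ) - (m : ℂ)) * x (k - m) := by
  refine Summable.of_norm_bounded (((hs.summable.mul_left (2 * |(k : ℝ)|)).add
    hs.summable_moment).mul_right ‖x‖) fun m => ?_
  rw [norm_mul, norm_mul, Complex.norm_real, Real.norm_of_nonneg (hs.nonneg m)]
  have h : ‖2 * (k : ℂ) - (m : ℂ)‖ ≤ 2 * |(k : ℝ)| + |(m : ℝ)| := by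
    refine (norm_sub_le _ _).trans ?_
    simp
  have := mul_le_mul_of_nonneg_left h (hs.nonneg m)
  refine mul_le_mul (by linarith) (norm_coord_le x _) (norm_nonneg _) ?_
  exact add_nonneg (mul_nonneg (by positivity) (hs.nonneg m))
    (mul_nonneg (by positivity) (hs.nonneg m))

theorem summable_shift (hs : IsMomentKernel s) (x : l2Z) (k : ℤ) :
    Summable fun m : ℤ => (s m : ℂ) * x (k - m) := by
  refine Summable.of_norm_bounded (hs.summable.mul_right ‖x‖) fun m => ?_
  rw [norm_mul, Complex.norm_real, Real.norm_of_nonneg (hs.nonneg m)]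
  exact mul_le_mul_of_nonneg_left (norm_coord_le x _) (hs.nonneg m)

theorem summable_cutoffTerm (hs : IsMomentKernel s) (N : ℕ) (x y : l2Z) :
    Summable (cutoffTerm s N x y) := by
  have hg : Summable fun m : ℤ => ((N : ℝ) + 1) * s m + |(m : ℝ)| * s m :=
    (hs.summable.mul_left _).add hs.summable_moment
  have hg0 : ∀ m : ℤ, 0 ≤ ((N : ℝ) + 1) * s m + |(m : ℝ)| * s m := fun m => by
    have := hs.nonneg m
    positivity
  refine Summable.of_norm_bounded (summable_weight_mul_shift hg0 hg x y) ?_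
  rintro ⟨m, k⟩
  simp only [cutoffTerm, norm_mul, Complex.norm_real, RCLike.norm_conj,
    Real.norm_of_nonneg (hs.nonneg m), Real.norm_of_nonneg (cutoff_nonneg N k)]
  refine mul_le_mul_of_nonneg_right ?_ (by positivity)
  have h : ‖2 * (k : ℂ) - (m : ℂ)‖ ≤ 2 * |(k : ℝ)| + |(m : ℝ)| := by
    refine (norm_sub_le _ _).trans ?_
    simp
  have h0 := cutoff_nonneg N k
  have h1 := cutoff_le_one N k
  have h2 := cutoff_mul_abs_le N k
  have h3 := mul_le_mul_of_nonneg_left h h0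
  have h4 := mul_le_mul_of_nonneg_right h1 (abs_nonneg (m : ℝ))
  have h5 : 0 ≤ |(m : ℝ)| := abs_nonneg _
  have h6 := mul_le_mul_of_nonneg_left
    (show (1 / 2) * (cutoff N k * ‖2 * (k : ℂ) - (m : ℂ)‖) ≤ (N + 1) + |(m : ℝ)| by linarith)
    (hs.nonneg m)
  have h7 : ‖(1 / 2 : ℂ)‖ = 1 / 2 := by norm_num
  rw [h7]
  linarith

theorem tsum_cutoffTerm (hs : IsMomentKernel s) (N : ℕ) {x x' : l2Z} (hx : IsKernelPair s x x')
    (y : l2Z) : ∑' p, cutoffTerm s N x y p = ∑' k, (cutoff N k : ℂ) * ⟪x' k, y k⟫ := by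
  have h := (hs.summable_cutoffTerm N x y)
  have h' : Summable fun p : ℤ × ℤ => cutoffTerm s N x y (p.2, p.1) :=
    (Equiv.prodComm ℤ ℤ).summable_iff.2 h
  rw [← (Equiv.prodComm ℤ ℤ).tsum_eq (cutoffTerm s N x y)]
  refine h'.tsum_prod.trans ?_
  refine tsum_congr fun k => ?_
  dsimp only
  rw [RCLike.inner_apply', hx k, map_mul, Complex.conj_tsum, ← tsum_mul_left, ← tsum_mul_right,
    ← tsum_mul_left]
  refine tsum_congr fun m => ?_
  have h2 : starRingEnd ℂ 2 = 2 := map_ofNat _ 2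
  simp [cutoffTerm, h2]
  ring

theorem tendsto_tsum_cutoff_mul_inner (x y : l2Z) :
    Tendsto (fun N => ∑' k, (cutoff N k : ℂ) * ⟪x k, y k⟫) atTop (𝓝 ⟪x, y⟫) := by
  rw [← (lp.hasSum_inner x y).tsum_eq]
  have hinner : Summable fun k => (⟪x k, y k⟫ : ℂ) := lp.summable_inner x y
  have hsum : Summable fun k => ‖(⟪x k, y k⟫ : ℂ)‖ := hinner.norm
  refine tendsto_tsum_of_dominated_convergence hsum
    (fun k => ?_) (Eventually.of_forall fun N k => ?_)
  · have h : Tendsto (fun N => (cutoff N k : ℂ)) atTop (𝓝 ((1 : ℝ) : ℂ)) :=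
      (Complex.continuous_ofReal.tendsto 1).comp (tendsto_cutoff k)
    have h' := h.mul_const (⟪x k, y k⟫ : ℂ)
    rwa [Complex.ofReal_one, one_mul] at h'
  · rw [norm_mul, Complex.norm_real, Real.norm_of_nonneg (cutoff_nonneg N k)]
    exact mul_le_of_le_one_left (norm_nonneg _) (cutoff_le_one N k)

theorem inner_eq_inner (hs : IsMomentKernel s) {x x' y y' : l2Z} (hx : IsKernelPair s x x')
    (hy : IsKernelPair s y y') : ⟪x', y⟫ = ⟪x, y'⟫ := by
  let e : ℤ × ℤ ≃ ℤ × ℤ :=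
    ⟨fun p => (-p.1, p.2 - p.1), fun p => (-p.1, p.2 - p.1), fun p => by simp, fun p => by simp⟩
  have hG := fun N => hs.summable_cutoffTerm N x y
  have hH : ∀ N, Summable fun p => starRingEnd ℂ (cutoffTerm s N y x (e p)) := fun N =>
    Complex.summable_conj.2 (e.summable_iff.2 (hs.summable_cutoffTerm N y x))
  have hHsum : ∀ N, ∑' p, starRingEnd ℂ (cutoffTerm s N y x (e p)) =
      ∑' k, (cutoff N k : ℂ) * ⟪x k, y' k⟫ := fun N => by
    rw [← Complex.conj_tsum, e.tsum_eq (cutoffTerm s N y x), hs.tsum_cutoffTerm N hy,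
      Complex.conj_tsum]
    refine tsum_congr fun k => ?_
    rw [map_mul, Complex.conj_ofReal, inner_conj_symm]
  have hdiff : ∀ N (p : ℤ × ℤ),
      cutoffTerm s N x y p - starRingEnd ℂ (cutoffTerm s N y x (e p)) =
        (((cutoff N p.2 - cutoff N (p.2 - p.1)) * ((1 / 2) * (s p.1 * (2 * p.2 - p.1))) : ℝ) : ℂ) *
          (starRingEnd ℂ (x (p.2 - p.1)) * y p.2) := by
    rintro N ⟨m, k⟩
    have h2 : starRingEnd ℂ 2 = 2 := map_ofNat _ 2
    simp [cutoffTerm, e, hs.even, h2]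
    ring
  have hlim : Tendsto (fun N => ∑' p, (cutoffTerm s N x y p -
      starRingEnd ℂ (cutoffTerm s N y x (e p)))) atTop (𝓝 (∑' _ : ℤ × ℤ, 0)) := by
    refine tendsto_tsum_of_dominated_convergence (summable_weight_mul_shift
      (fun m => mul_nonneg (abs_nonneg _) (hs.nonneg m)) hs.summable_moment x y)
      (fun p => ?_) (Eventually.of_forall fun N p => ?_)
    · simp_rw [hdiff]
      have h := (((tendsto_cutoff p.2).sub (tendsto_cutoff (p.2 - p.1))).mul_const
        ((1 / 2) * (s p.1 * (2 * p.2 - p.1))))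
      rw [sub_self, zero_mul] at h
      simpa using ((Complex.continuous_ofReal.tendsto 0).comp h).mul_const
        (starRingEnd ℂ (x (p.2 - p.1)) * y p.2)
    · rw [hdiff, norm_mul, norm_mul, RCLike.norm_conj, Complex.norm_real]
      refine mul_le_mul_of_nonneg_right ?_ (by positivity)
      rw [Real.norm_eq_abs, abs_mul, abs_mul, abs_mul, abs_of_nonneg (hs.nonneg p.1)]
      have h := mul_le_mul_of_nonneg_right (abs_cutoff_sub_mul_le N p.2 p.1) (hs.nonneg p.1)
      have h2 : |(1 / 2 : ℝ)| = 1 / 2 := by norm_num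
      rw [h2]
      linarith
  rw [tsum_zero] at hlim
  have hlim' := (tendsto_tsum_cutoff_mul_inner x' y).sub (tendsto_tsum_cutoff_mul_inner x y')
  refine sub_eq_zero.1 (tendsto_nhds_unique hlim' (hlim.congr fun N => ?_))
  rw [(hG N).tsum_sub (hH N), hHsum, hs.tsum_cutoffTerm N hx]

/-- An operator acting by the kernel on a domain containing the basis vectors is symmetric, and so
is its adjoint. -/
theorem isEssSymm (hs : IsMomentKernel s) {A : l2Z →ₗ.[ℂ] l2Z}
    (hdom : ∀ k : ℤ, (lp.single 2 k 1 : l2Z) ∈ A.domain)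
    (hA : ∀ φ : A.domain, IsKernelPair s φ (A φ)) : IsEssSymm A := by
  have hadj : ∀ {x x' : l2Z}, AdjointMapsTo A x x' → IsKernelPair s x x' := by
    intro x x' hx k
    have h := hx ⟨_, hdom k⟩
    rw [inner_single_one] at h
    rw [← h, ← (lp.hasSum_inner _ _).tsum_eq, ← (Equiv.subLeft k).tsum_eq, ← tsum_mul_left]
    refine tsum_congr fun m => ?_
    rw [RCLike.inner_apply', hA ⟨_, hdom k⟩, tsum_eq_single (-m)]
    · have h2 : starRingEnd ℂ 2 = 2 := map_ofNat _ 2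
      simp [hs.even, h2]
      ring
    · intro j hj
      rw [lp.single_apply, Pi.single_eq_of_ne, mul_zero]
      simp only [Equiv.subLeft_apply]
      omega
  exact ⟨fun φ ψ => hs.inner_eq_inner (hA ψ) (hA φ),
    fun x x' y y' hx hy => hs.inner_eq_inner (hadj hx) (hadj hy)⟩

theorem hasCommutator_shift (hs : IsMomentKernel s) {A : l2Z →ₗ.[ℂ] l2Z}
    (hA : ∀ φ : A.domain, IsKernelPair s φ (A φ)) {T S : l2Z →L[ℂ] l2Z}
    (hT : ∀ (φ : l2Z) (k : ℤ), (T φ) k = φ (k - 1))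
    (hS : ∀ (φ : l2Z) (k : ℤ), (S φ) k = ∑' m : ℤ, (s m : ℂ) * φ (k - m)) :
    HasCommutator A T (T * S) := by
  intro φ ψ
  have h : IsKernelPair s (T ψ) (T (A ψ) + T (S ψ)) := by
    intro k
    rw [lp.coeFn_add, Pi.add_apply, hT, hT, hA ψ, hS, ← tsum_mul_left, ← tsum_mul_left,
      ← ((hs.summable_row ψ (k - 1)).mul_left _).tsum_add (hs.summable_shift ψ (k - 1))]
    refine tsum_congr fun m => ?_
    rw [hT, sub_right_comm]
    push_cast
    ring
  rw [hs.inner_eq_inner (hA φ) h, inner_add_right, add_sub_cancel_left]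
  rfl

end IsMomentKernel

/-- The kernel `a ^ (-|m|)` without its diagonal term. -/
def expKernel (a : ℝ) (m : ℤ) : ℝ := if m = 0 then 0 else a ^ (-|m|)

theorem isMomentKernel_expKernel {a : ℝ} (ha : 1 < a) : IsMomentKernel (expKernel a) := by
  have ha0 : 0 < a := by linarith
  have hnonneg : ∀ m, 0 ≤ expKernel a m := fun m => by
    unfold expKernel
    split_ifs
    · rfl
    · positivity
  have heven : ∀ m, expKernel a (-m) = expKernel a m := fun m => by simp [expKernel]
  have hle : ∀ n : ℕ, expKernel a n ≤ a⁻¹ ^ n := fun n => by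
    unfold expKernel
    split_ifs
    · positivity
    · simp
  have hr : ‖a⁻¹‖ < 1 := by
    rw [Real.norm_of_nonneg (by positivity)]
    exact inv_lt_one_of_one_lt₀ ha
  have h0 : Summable fun n : ℕ => expKernel a n :=
    (summable_geometric_of_norm_lt_one hr).of_nonneg_of_le (fun n => hnonneg n) hle
  have h1 : Summable fun n : ℕ => |((n : ℤ) : ℝ)| * expKernel a n := by
    refine (summable_pow_mul_geometric_of_norm_lt_one 1 hr).of_nonneg_of_le
      (fun n => mul_nonneg (abs_nonneg _) (hnonneg n)) fun n => ?_
    simpa using mul_le_mul_of_nonneg_left (hle n) (Nat.cast_nonneg (α := ℝ) n)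
  refine ⟨hnonneg, heven, summable_int_iff_summable_nat_and_neg.2 ⟨h0, by simpa [heven] using h0⟩,
    summable_int_iff_summable_nat_and_neg.2 ⟨h1, ?_⟩⟩
  simpa [heven] using h1

theorem opNorm_le_of_coord_le {B : l2Z →L[ℂ] l2Z} {C : ℝ} (hC : 0 ≤ C) (m : ℤ)
    (h : ∀ (φ : l2Z) (k : ℤ), ‖(B φ) k‖ ≤ C * ‖φ (k - m)‖) : ‖B‖ ≤ C := by
  refine B.opNorm_le_bound hC fun φ => ?_
  refine le_of_sq_le_sq ?_ (by positivity)
  rw [mul_pow]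
  refine hasSum_le (fun k => ?_) (hasSum_norm_sq (B φ)) ((hasSum_norm_sq_sub φ m).mul_left (C ^ 2))
  rw [← mul_pow]
  exact pow_le_pow_left₀ (norm_nonneg _) (h φ k) 2

theorem star_shift_apply {T : l2Z →L[ℂ] l2Z} (hT : ∀ (φ : l2Z) (k : ℤ), (T φ) k = φ (k - 1))
    (φ : l2Z) (k : ℤ) : (star T φ) k = φ (k - (-1)) := by
  have h : T (lp.single 2 k 1) = lp.single 2 (k + 1) 1 := by
    ext j
    rw [hT, lp.single_apply, lp.single_apply, Pi.single_apply, Pi.single_apply]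
    simp only [sub_eq_iff_eq_add]
  rw [← inner_single_one, ContinuousLinearMap.star_eq_adjoint,
    ContinuousLinearMap.adjoint_inner_right, h, inner_single_one, sub_neg_eq_add]

theorem star_diagonal_apply {D : l2Z →L[ℂ] l2Z} {d : ℤ → ℂ}
    (hD : ∀ (φ : l2Z) (k : ℤ), (D φ) k = d k * φ k) (φ : l2Z) (k : ℤ) :
    (star D φ) k = starRingEnd ℂ (d k) * φ k := by
  have h : D (lp.single 2 k 1) = d k • lp.single 2 k 1 := by
    ext j
    rw [hD, lp.coeFn_smul, Pi.smul_apply, lp.single_apply, smul_eq_mul]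
    by_cases hj : j = k
    · rw [hj]
    · rw [Pi.single_eq_of_ne hj, mul_zero, mul_zero]
  rw [← inner_single_one, ContinuousLinearMap.star_eq_adjoint,
    ContinuousLinearMap.adjoint_inner_right, h, inner_smul_left, inner_single_one]

theorem shift_norm_le_one {U : l2Z →L[ℂ] l2Z} {σ : ℤ}
    (hU : ∀ (φ : l2Z) (k : ℤ), (U φ) k = φ (k - σ)) : ‖U‖ ≤ 1 :=
  opNorm_le_of_coord_le zero_le_one σ fun φ k => by rw [hU, one_mul]

/-- The geometric series `∑ (c U) ^ (n + 1)` of a shift `U`. -/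
theorem exists_geometric_shift {U : l2Z →L[ℂ] l2Z} {σ : ℤ}
    (hU : ∀ (φ : l2Z) (k : ℤ), (U φ) k = φ (k - σ)) {c : ℂ} (hc : ‖c‖ < 1) :
    ‖c • U‖ < 1 ∧ ∃ P : l2Z →L[ℂ] l2Z, P = c • U + (c • U) * P ∧
      ∀ (φ : l2Z) (k : ℤ), HasSum (fun n : ℕ => c ^ (n + 1) * φ (k - (n + 1) * σ)) ((P φ) k) := by
  have hlt : ‖c • U‖ < 1 := by
    rw [norm_smul]
    exact (mul_le_of_le_one_right (norm_nonneg _) (shift_norm_le_one hU)).trans_lt hc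
  refine ⟨hlt, (c • U) * ∑' n : ℕ, (c • U) ^ n, ?_, fun φ k => ?_⟩
  · have h := mul_neg_geom_series (c • U) hlt
    rw [sub_mul, one_mul, sub_eq_iff_eq_add] at h
    nth_rewrite 1 [h]
    rw [mul_add, mul_one]
  · have hpow : ∀ (n : ℕ) (k : ℤ), (((c • U) ^ n) φ) k = c ^ n * φ (k - n * σ) := by
      intro n
      induction n with
      | zero => simp
      | succ n ih =>
        intro k
        rw [pow_succ', mul_apply_eq_comp, smul_apply, lp.coeFn_smul, Pi.smul_apply, hU, ih,
          smul_eq_mul, ← mul_assoc, ← pow_succ', sub_sub]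
        push_cast
        ring_nf
    have hs := (summable_geometric_of_norm_lt_one hlt).hasSum.mul_left (c • U)
    have h1 := hs.mapL (ContinuousLinearMap.apply ℂ l2Z φ)
    have h2 := h1.mapL (lp.evalCLM ℂ (fun _ : ℤ => ℂ) 2 k)
    refine h2.congr_fun fun n => ?_
    change _ = ((c • U * (c • U) ^ n) φ) k
    rw [← pow_succ', hpow]
    push_cast
    rfl

theorem IsCn.shift {a : ℝ} (ha : 1 < a) {A : l2Z →ₗ.[ℂ] l2Z} (hA : IsEssSymm A)
    (hker : ∀ φ : A.domain, IsKernelPair (expKernel a) φ (A φ)) {T : l2Z →L[ℂ] l2Z}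
    (hT : ∀ (φ : l2Z) (k : ℤ), (T φ) k = φ (k - 1)) (n : ℕ) : IsCn A n T := by
  have hc : ‖((a⁻¹ : ℝ) : ℂ)‖ < 1 := by
    rw [Complex.norm_real, Real.norm_of_nonneg (by positivity)]
    exact inv_lt_one_of_one_lt₀ ha
  obtain ⟨hlt, P, hP, hPsum⟩ := exists_geometric_shift hT hc
  obtain ⟨hlt', Q, hQ, hQsum⟩ := exists_geometric_shift (star_shift_apply hT) hc
  have hS : ∀ (φ : l2Z) (k : ℤ),
      ((P + Q) φ) k = ∑' m : ℤ, (expKernel a m : ℂ) * φ (k - m) := by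
    intro φ k
    have hexp : ∀ j : ℕ, expKernel a (j + 1) = a⁻¹ ^ (j + 1) := fun j => by
      have h1 : (j : ℤ) + 1 ≠ 0 := by omega
      have h2 : |(j : ℤ) + 1| = ((j + 1 : ℕ) : ℤ) := by
        rw [abs_of_nonneg (by positivity)]
        push_cast
        rfl
      rw [expKernel, if_neg h1, h2, zpow_neg, zpow_natCast, inv_pow]
    have h := HasSum.of_add_one_of_neg_add_one
      (f := fun m : ℤ => (expKernel a m : ℂ) * φ (k - m)) (m := (P φ) k) (m' := (Q φ) k) ?_ ?_
    · rw [h.tsum_eq]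
      simp [expKernel]
    · refine (hPsum φ k).congr_fun fun j => ?_
      rw [hexp, mul_one, Complex.ofReal_pow]
    · refine (hQsum φ k).congr_fun fun j => ?_
      rw [(isMomentKernel_expKernel ha).even, hexp, mul_neg_one, Complex.ofReal_pow]
  induction n with
  | zero => exact zero_order
  | succ n ih =>
    refine succ_iff.2
      ⟨_, (isMomentKernel_expKernel ha).hasCommutator_shift hker hT hS, ih.mul hA (.add ?_ ?_)⟩
    · exact of_eq_add_mul_add_mul hA (ih.smul _) (ih.smul _) zero (by simpa using hlt)
        (by simpa using hP)
    · exact of_eq_add_mul_add_mul hA (ih.star.smul _) (ih.star.smul _) zero (by simpa using hlt')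
        (by simpa using hQ)

theorem IsCn.diagonal_sqrt {A : l2Z →ₗ.[ℂ] l2Z} (hA : IsEssSymm A) {n : ℕ} {γ : ℤ → ℂ} {b : ℝ}
    (hb : b < 1) (hγ : ∀ k, ‖γ k‖ ≤ b) {D1 D2 : l2Z →L[ℂ] l2Z}
    (hD1 : ∀ (φ : l2Z) (k : ℤ), (D1 φ) k = γ k * φ k)
    (hD2 : ∀ (φ : l2Z) (k : ℤ), (D2 φ) k = (Real.sqrt (1 - ‖γ k‖ ^ 2) : ℂ) * φ k)
    (h : IsCn A n D1) : IsCn A n D2 := by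
  have hb0 : 0 ≤ b := (norm_nonneg _).trans (hγ 0)
  have hbsq : 0 < 1 - b ^ 2 := by nlinarith
  have hsq : ∀ k, ‖γ k‖ ^ 2 ≤ b ^ 2 := fun k => pow_le_pow_left₀ (norm_nonneg _) (hγ k) 2
  have hle : ∀ k, Real.sqrt (1 - b ^ 2) ≤ Real.sqrt (1 - ‖γ k‖ ^ 2) := fun k =>
    Real.sqrt_le_sqrt (by linarith [hsq k])
  have hle_one : ∀ k, Real.sqrt (1 - ‖γ k‖ ^ 2) ≤ 1 := fun k =>
    Real.sqrt_le_one.2 (by nlinarith [norm_nonneg (γ k)])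
  have hY : ∀ (φ : l2Z) (k : ℤ), ((D1 * star D1) φ) k = γ k * (starRingEnd ℂ (γ k) * φ k) :=
    fun φ k => by rw [mul_apply_eq_comp, hD1, star_diagonal_apply hD1]
  have hZ : ∀ (φ : l2Z) (k : ℤ),
      ((1 - D2) φ) k = ((1 - Real.sqrt (1 - ‖γ k‖ ^ 2) : ℝ) : ℂ) * φ k := fun φ k => by
    rw [sub_apply, lp.coeFn_sub, Pi.sub_apply, hD2, one_apply_eq_self]
    push_cast
    ring
  have hD : D2 = 1 - (1 - D2) := by abel
  rw [hD]
  refine (one hA).sub (of_eq_half_add_mul_self hA (Y := D1 * star D1)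
    (z := 1 - Real.sqrt (1 - b ^ 2)) ?_ ?_ ?_ (h.mul hA h.star) ?_)
  · linarith [Real.sqrt_pos.2 hbsq]
  · refine opNorm_le_of_coord_le ?_ 0 fun φ k => ?_
    · linarith [hle 0, hle_one 0]
    · rw [hZ, norm_mul, Complex.norm_real, sub_zero,
        Real.norm_of_nonneg (by linarith [hle_one k])]
      exact mul_le_mul_of_nonneg_right (by linarith [hle k]) (norm_nonneg _)
  · have : 2 * (1 - Real.sqrt (1 - b ^ 2)) - (1 - Real.sqrt (1 - b ^ 2)) ^ 2 = b ^ 2 := by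
      linear_combination -Real.sq_sqrt hbsq.le
    rw [this]
    refine opNorm_le_of_coord_le (by positivity) 0 fun φ k => ?_
    rw [hY, norm_mul, norm_mul, RCLike.norm_conj, ← mul_assoc, ← sq, sub_zero]
    exact mul_le_mul_of_nonneg_right (hsq k) (norm_nonneg _)
  · ext φ k
    have hs : ((Real.sqrt (1 - ‖γ k‖ ^ 2) : ℝ) : ℂ) ^ 2 = 1 - γ k * starRingEnd ℂ (γ k) := by
      rw [← Complex.ofReal_pow, Real.sq_sqrt (by linarith [hsq k]), Complex.mul_conj']
      push_cast
      rfl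
    rw [smul_apply, lp.coeFn_smul, Pi.smul_apply, add_apply, lp.coeFn_add, Pi.add_apply, hY,
      mul_apply_eq_comp, hZ, hZ, hZ, smul_eq_mul]
    push_cast
    linear_combination (-1 / 2 * φ k) * hs

/-- Lemma 3.11 ("ggt2"), integer-order case: if `D₁(γ) ∈ Cⁿ(A_a)` then
`D₂(γ) ∈ Cⁿ(A_a)` and the GGT operator
`H(γ) = T*D₂(γ) − T*D₁(γ)T(I − D₂(γ)T)⁻¹D₁(γ)*` belongs to `Cⁿ(A_a)`. -/
theorem stmt6 (a : ℝ) (ha : 1 < a) (γ : ℤ → ℂ)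
    (hlow : ∃ b > (0 : ℝ), ∀ k : ℤ, b ≤ ‖γ k‖)
    (hupp : ∃ B < (1 : ℝ), ∀ k : ℤ, ‖γ k‖ ≤ B)
    (n : ℕ)
    -- the conjugate operator A_a, with domain D_X and the prescribed action
    (Aa : l2Z →ₗ.[ℂ] l2Z)
    (hdom : ∀ φ : l2Z,
      φ ∈ Aa.domain ↔ Summable fun k : ℤ => (1 + (k : ℝ) ^ 2) * ‖φ k‖ ^ 2)
    (haction : ∀ (φ : l2Z) (hφ : φ ∈ Aa.domain) (k : ℤ),
      (Aa ⟨φ, hφ⟩ : l2Z) k = (1 / 2 : ℂ) * ∑' m : ℤ,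
        (if m = 0 then 0 else
          ((a ^ (-|m|) : ℝ) : ℂ) * (2 * (k : ℂ) - (m : ℂ)) * φ (k - m)))
    -- the shift T, diagonal operators D₁(γ), D₂(γ), and R = (I − D₂(γ)T)⁻¹
    (T D1 D2 R : l2Z →L[ℂ] l2Z)
    (hT : ∀ (φ : l2Z) (k : ℤ), (T φ) k = φ (k - 1))
    (hD1 : ∀ (φ : l2Z) (k : ℤ), (D1 φ) k = γ k * φ k)
    (hD2 : ∀ (φ : l2Z) (k : ℤ), (D2 φ) k = (Real.sqrt (1 - ‖γ k‖ ^ 2) : ℂ) * φ k)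
    (hR : R * (1 - D2 * T) = 1 ∧ (1 - D2 * T) * R = 1)
    -- hypothesis: D₁(γ) is of class Cⁿ(A_a)
    (hC : IsCn Aa n D1) :
    IsCn Aa n D2 ∧ IsCn Aa n (star T * D2 - star T * D1 * T * R * star D1) := by
  obtain ⟨b, hb0, hb⟩ := hlow
  obtain ⟨B, hB1, hB⟩ := hupp
  have hs := isMomentKernel_expKernel ha
  have hker : ∀ φ : Aa.domain, IsKernelPair (expKernel a) φ (Aa φ) := fun φ k => by
    rw [haction φ φ.2 k]
    congr 1
    refine tsum_congr fun m => ?_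
    unfold expKernel
    split_ifs <;> simp
  have hA : IsEssSymm Aa := hs.isEssSymm (fun k => by
    rw [hdom]
    refine summable_of_ne_finset_zero (s := {k}) fun j hj => ?_
    rw [Finset.mem_singleton] at hj
    rw [lp.single_apply, Pi.single_eq_of_ne hj]
    simp) hker
  have hTn : IsCn Aa n T := .shift ha hA hker hT n
  have hD2n : IsCn Aa n D2 := hC.diagonal_sqrt hA hB1 hB hD1 hD2
  have hnorm : ‖D2 * T‖ ≤ Real.sqrt (1 - b ^ 2) := by
    refine opNorm_le_of_coord_le (Real.sqrt_nonneg _) 1 fun φ k => ?_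
    rw [mul_apply_eq_comp, hD2, hT, norm_mul, Complex.norm_real,
      Real.norm_of_nonneg (Real.sqrt_nonneg _)]
    refine mul_le_mul_of_nonneg_right (Real.sqrt_le_sqrt ?_) (norm_nonneg _)
    linarith [pow_le_pow_left₀ hb0.le (hb k) 2]
  have hlt : ‖D2 * T‖ < 1 := by
    refine hnorm.trans_lt ((Real.sqrt_lt' one_pos).2 ?_)
    nlinarith
  have hRn : IsCn Aa n R := by
    refine .of_eq_add_mul_add_mul hA (.one hA) (hD2n.mul hA hTn) .zero (by simpa using hlt) ?_
    have h := hR.2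
    rw [sub_mul, one_mul, sub_eq_iff_eq_add] at h
    rwa [mul_zero, add_zero]
  exact ⟨hD2n, (hTn.star.mul hA hD2n).sub
    ((((hTn.star.mul hA hC).mul hA hTn).mul hA hRn).mul hA hC.star)⟩
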